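/- For every α, β ∈ (0,1), the limits lim_{k→∞} (1/k) H(X_2^{k−1} | y(X_2^{k−1}, D_2^{k−1}), D_1, D_k) and lim_{k→∞} (1/k) H(X^k | y(X^k, D^k), D_0, D_{k+1}) both exist and are equal. -/

import Mathlib

open Filter

noncomputable section

open scoped Classical

namespace SyncDeletion

/-- The deletion output `y(x, d)`: the subsequence of `x` consisting of the bits `x i`
with `d i = false`, in order. -/
def yList (x d : List Bool) : List Bool :=
  ((x.zip d).filter (fun p => p.2 = false)).map Prod.fst

/-- Binary entropy function (base-2), with `binEnt 0 = binEnt 1 = 0`. -/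
def binEnt (p : ℝ) : ℝ := -(p * Real.logb 2 p) - (1 - p) * Real.logb 2 (1 - p)

/-- The constant `C = ∑_{l≥1} 2^{-l-1} l log₂ l` (the `l = 0` term vanishes). -/
def Cconst : ℝ := ∑' l : ℕ, (2 : ℝ) ^ (-(l : ℝ) - 1) * (l : ℝ) * Real.logb 2 (l : ℝ)

/-- Probability of an event `E` under a pmf `p` on a finite outcome space. -/
def prob {Ω : Type} [Fintype Ω] (p : Ω → ℝ) (E : Ω → Prop) : ℝ :=
  ∑ ω ∈ Finset.univ.filter E, p ω

/-- Conditional Shannon entropy (in bits) `H(f | g)` of the random variable `f`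
given `g`, under the pmf `p`. -/
def condEnt {Ω A B : Type} [Fintype Ω] (p : Ω → ℝ) (f : Ω → A) (g : Ω → B) : ℝ :=
  -∑ ab ∈ Finset.univ.image (fun ω => (f ω, g ω)),
    (if prob p (fun ω => f ω = ab.1 ∧ g ω = ab.2) = 0 then 0
     else prob p (fun ω => f ω = ab.1 ∧ g ω = ab.2) *
       Real.logb 2 (prob p (fun ω => f ω = ab.1 ∧ g ω = ab.2) /
         prob p (fun ω => g ω = ab.2)))

/-- Shannon entropy (in bits) `H(f)` of the random variable `f` under the pmf `p`. -/
def ent {Ω A : Type} [Fintype Ω] (p : Ω → ℝ) (f : Ω → A) : ℝ :=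
  condEnt p f (fun _ => ())

/-- Stationary initial distribution of the deletion-pattern Markov chain:
`P(D₀ = 1) = β/(α+β)`. -/
def initD (α β : ℝ) (b : Bool) : ℝ := if b then β / (α + β) else α / (α + β)

/-- Transition probabilities of the deletion-pattern Markov chain:
`P(1|1) = 1-α`, `P(0|1) = α`, `P(1|0) = β`, `P(0|0) = 1-β`. -/
def transD (α β : ℝ) (b b' : Bool) : ℝ :=
  if b then (if b' then 1 - α else α) else (if b' then β else 1 - β)

/-- Probability of a trajectory of the stationary two-state Markov chain. -/
def pMarkov (α β : ℝ) {m : ℕ} (dp : Fin (m + 1) → Bool) : ℝ :=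
  initD α β (dp 0) * ∏ i : Fin m, transD α β (dp i.castSucc) (dp i.succ)

/-- Joint pmf of the iid Bernoulli(1/2) source `X^n = ω.1` and the independent
deletion pattern `(D_0, …, D_{n+1}) = ω.2`. -/
def pJoint (α β : ℝ) (n : ℕ) (ω : (Fin n → Bool) × (Fin (n + 2) → Bool)) : ℝ :=
  (1 / 2 : ℝ) ^ n * pMarkov α β (m := n + 1) ω.2

/-- The deletion output `y(X^n, D^n)`: bits `X_i` with `D_i = 0` in order
(source bit `X_i` is governed by pattern bit `D_i`, i.e. index `i` of `ω.2`,
for `i = 1, …, n`). -/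
def yOut {n : ℕ} (ω : (Fin n → Bool) × (Fin (n + 2) → Bool)) : List Bool :=
  yList (List.ofFn ω.1)
    (List.ofFn (fun i : Fin n => ω.2 ⟨i.val + 1, by have := i.isLt; omega⟩))

/-- `a_n = H(X^n | y(X^n, D^n), D_0, D_{n+1})`. -/
def aSeq (α β : ℝ) (n : ℕ) : ℝ :=
  condEnt (pJoint α β n) (fun ω => ω.1)
    (fun ω => (yOut ω, ω.2 0, ω.2 (Fin.last (n + 1))))

/-- `E_n = H(D_1 | D_0, X^n, y(X^n, D^n), D_{n+1})`. -/
def Eseq (α β : ℝ) (n : ℕ) : ℝ :=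
  condEnt (pJoint α β n) (fun ω => ω.2 1)
    (fun ω => (ω.2 0, ω.1, yOut ω, ω.2 (Fin.last (n + 1))))

/-- `H(y(X^n, D^n) | X^n, D_0, D_{n+1})`. -/
def hygSeq (α β : ℝ) (n : ℕ) : ℝ :=
  condEnt (pJoint α β n) (fun ω => yOut ω)
    (fun ω => (ω.1, ω.2 0, ω.2 (Fin.last (n + 1))))

/-- `J_n = d + (1/n) H(y(X^n, D^n) | X^n, D_0, D_{n+1})` with `d = β/(α+β)`. -/
def Jseq (α β : ℝ) (n : ℕ) : ℝ := β / (α + β) + hygSeq α β n / n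

/-- `I_n/n`: the normalized mutual information
`(1/n)(H(y(X^n,D^n)) - H(y(X^n,D^n)|X^n))`. -/
def Iseq (α β : ℝ) (n : ℕ) : ℝ :=
  (ent (pJoint α β n) (fun ω => yOut ω) -
    condEnt (pJoint α β n) (fun ω => yOut ω) (fun ω => ω.1)) / n

/-- Error probability of a code `(enc, dec)` with message set `Fin M`. -/
def errProb (α β : ℝ) (n M : ℕ) (enc : (Fin n → Bool) → Fin M)
    (dec : Fin M × List Bool → (Fin n → Bool)) : ℝ :=
  prob (pJoint α β n) (fun ω => dec (enc ω.1, yOut ω) ≠ ω.1)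

/-- `R` is an achievable rate: there is a sequence of codes whose error probability
tends to `0` and whose rate `(1/n) log₂ |M_n|` has limsup at most `R`. -/
def IsAchievable (α β R : ℝ) : Prop :=
  ∃ M : ℕ → ℕ, ∃ enc : (n : ℕ) → (Fin n → Bool) → Fin (M n),
    ∃ dec : (n : ℕ) → Fin (M n) × List Bool → (Fin n → Bool),
      Tendsto (fun n => errProb α β n (M n) (enc n) (dec n)) atTop (nhds 0) ∧
      Filter.limsup (fun n : ℕ => Real.logb 2 (M n : ℝ) / (n : ℝ)) atTop ≤ R

/-- The minimum achievable rate `R_min(α, β)`. -/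
def Rmin (α β : ℝ) : ℝ := sInf {R : ℝ | IsAchievable α β R}

/-- `k = max {6, -6 / log₂(1-α)}`. -/
def kconst (α : ℝ) : ℝ := max 6 (-6 / Real.logb 2 (1 - α))

/-- `m = ⌊-k log₂ β⌋`. -/
def mlen (α β : ℝ) : ℕ := ⌊kconst α * (-Real.logb 2 β)⌋₊

/-- Number of ones among the entries of `dp` with index `≤ m`. -/
def onesCount {N : ℕ} (dp : Fin N → Bool) (m : ℕ) : ℕ :=
  (Finset.univ.filter (fun i : Fin N => i.val ≤ m ∧ dp i = true)).card

/-- Number of maximal runs of 1's among the entries of `dp` with index `≤ m`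
(counted by their starting positions). -/
def runsCount {N : ℕ} (dp : Fin N → Bool) (m : ℕ) : ℕ :=
  (Finset.univ.filter (fun i : Fin N => i.val ≤ m ∧ dp i = true ∧
    (i.val = 0 ∨ dp ⟨i.val - 1, lt_of_le_of_lt (Nat.sub_le _ _) i.isLt⟩ = false))).card

/-- The deletion pattern `(D_0, …, D_{n+1})` is typical: `(D_0, …, D_m)` contains at
most one maximal run of 1's and at most `⌊(k/3)(-log₂ β)⌋` ones, for `m = ⌊-k log₂ β⌋`. -/
def Typical (α β : ℝ) {n : ℕ} (dp : Fin (n + 2) → Bool) : Prop :=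
  runsCount dp (mlen α β) ≤ 1 ∧
    onesCount dp (mlen α β) ≤ ⌊(kconst α / 3) * (-Real.logb 2 β)⌋₊

/-- The joint pmf conditioned on the event `{T = 1}` that the deletion pattern is typical. -/
def pTypCond (α β : ℝ) (n : ℕ) (ω : (Fin n → Bool) × (Fin (n + 2) → Bool)) : ℝ :=
  if Typical α β ω.2 then
    pJoint α β n ω / prob (pJoint α β n) (fun ω' => Typical α β ω'.2)
  else 0

/-- `H(D_1 | X^n, y(X^n,D^n), D_0, D_{n+1}, T = 1) ⬝ P(T = 1)`. -/
def EseqTyp (α β : ℝ) (n : ℕ) : ℝ :=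
  condEnt (pTypCond α β n) (fun ω => ω.2 1)
    (fun ω => (ω.2 0, ω.1, yOut ω, ω.2 (Fin.last (n + 1)))) *
  prob (pJoint α β n) (fun ω => Typical α β ω.2)

/-- `(1/k) H(X_2^{k-1} | y(X_2^{k-1}, D_2^{k-1}), D_1, D_k)` (unnormalized). -/
def innerEnt (α β : ℝ) (k : ℕ) : ℝ :=
  condEnt (pJoint α β k)
    (fun ω => (fun i : Fin (k - 2) => ω.1 ⟨i.val + 1, by have := i.isLt; omega⟩))
    (fun ω =>
      (yList (List.ofFn (fun i : Fin (k - 2) => ω.1 ⟨i.val + 1, by have := i.isLt; omega⟩))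
        (List.ofFn (fun i : Fin (k - 2) => ω.2 ⟨i.val + 2, by have := i.isLt; omega⟩)),
       ω.2 1, ω.2 ⟨k, by omega⟩))


section Entropy

variable {Ω A B : Type} [Fintype Ω]

lemma prob_eq_sum_ite (p : Ω → ℝ) (E : Ω → Prop) :
    prob p E = ∑ ω, if E ω then p ω else 0 := by
  simp [prob, Finset.sum_filter]

lemma prob_pos {p : Ω → ℝ} (hp : ∀ ω, 0 < p ω) {E : Ω → Prop} {ω : Ω} (h : E ω) :
    0 < prob p E :=
  Finset.sum_pos (fun i _ => hp i) ⟨ω, by simpa using h⟩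

lemma prob_nonneg {p : Ω → ℝ} (hp : ∀ ω, 0 < p ω) (E : Ω → Prop) : 0 ≤ prob p E :=
  Finset.sum_nonneg fun i _ => (hp i).le

/-- The conditional probability `P(f = f ω | g = g ω)`. -/
def condProb (p : Ω → ℝ) (f : Ω → A) (g : Ω → B) (ω : Ω) : ℝ :=
  prob p (fun ω' => f ω' = f ω ∧ g ω' = g ω) / prob p (fun ω' => g ω' = g ω)

lemma condProb_pos {p : Ω → ℝ} (hp : ∀ ω, 0 < p ω) (f : Ω → A) (g : Ω → B) (ω : Ω) :
    0 < condProb p f g ω :=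
  div_pos (prob_pos hp ⟨rfl, rfl⟩) (prob_pos hp rfl)

lemma condEnt_eq_sum {p : Ω → ℝ} (hp : ∀ ω, 0 < p ω) (f : Ω → A) (g : Ω → B) :
    condEnt p f g = -∑ ω, p ω * Real.logb 2 (condProb p f g ω) := by
  unfold condEnt
  congr 1
  apply Finset.sum_image'
  intro ω _
  have hpos : 0 < prob p (fun ω' => f ω' = f ω ∧ g ω' = g ω) := prob_pos hp ⟨rfl, rfl⟩
  rw [if_neg hpos.ne']
  conv_lhs => enter [1]; rw [prob]
  rw [Finset.sum_mul]
  apply Finset.sum_congr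
  · ext j; simp
  · intro j hj
    simp only [Finset.mem_filter, Finset.mem_univ, true_and, Prod.mk.injEq] at hj
    simp only [condProb, hj.1, hj.2]

/-- Summing `G (f ω)` weighted by the conditional law of `ω` given `f`. -/
lemma sum_mul_div_prob [DecidableEq A] {p : Ω → ℝ} (hp : ∀ ω, 0 < p ω) (f : Ω → A) (G : A → ℝ) :
    ∑ ω, p ω * (G (f ω) / prob p (fun ω' => f ω' = f ω)) =
      ∑ a ∈ Finset.univ.image f, G a := by
  symm
  apply Finset.sum_image'
  intro ω _
  have hpos : 0 < prob p (fun ω' => f ω' = f ω) := prob_pos hp rfl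
  rw [Finset.sum_congr rfl (g := fun j => p j * (G (f ω) / prob p (fun ω' => f ω' = f ω)))]
  · rw [← Finset.sum_mul]
    have hfib : ∑ j with f j = f ω, p j = prob p (fun ω' => f ω' = f ω) := by
      rw [prob_eq_sum_ite, Finset.sum_filter]
      congr!
    rw [hfib]
    field_simp
  · intro j hj
    simp only [Finset.mem_filter, Finset.mem_univ, true_and] at hj
    simp only [hj]

lemma sum_prob_eq (p : Ω → ℝ) (g : Ω → B) :
    ∑ b ∈ Finset.univ.image g, prob p (fun ω => g ω = b) = ∑ ω, p ω := by
  apply Finset.sum_image'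
  intro ω _
  rfl

lemma sum_prob_and_eq (p : Ω → ℝ) (f : Ω → A) (E : Ω → Prop) :
    ∑ a ∈ Finset.univ.image f, prob p (fun ω => f ω = a ∧ E ω) = prob p E := by
  rw [prob_eq_sum_ite p E]
  apply Finset.sum_image'
  intro ω _
  rw [prob_eq_sum_ite, Finset.sum_filter]
  refine Finset.sum_congr rfl fun j _ => ?_
  by_cases h : f j = f ω <;> simp [h]

/-- Gibbs' inequality for conditional entropy. -/
lemma condEnt_le_of_subprobability {p : Ω → ℝ} (hp : ∀ ω, 0 < p ω) (hsum : ∑ ω, p ω = 1)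
    (f : Ω → A) (g : Ω → B) (q : A → B → ℝ) (hq : ∀ a b, 0 ≤ q a b)
    (hqpos : ∀ ω, 0 < q (f ω) (g ω))
    (hqsum : ∀ b, ∑ a ∈ Finset.univ.image f, q a b ≤ 1) :
    condEnt p f g ≤ -∑ ω, p ω * Real.logb 2 (q (f ω) (g ω)) := by
  rw [condEnt_eq_sum hp, neg_le_neg_iff, ← sub_nonpos, ← Finset.sum_sub_distrib]
  have hlog2 : 0 < Real.log 2 := Real.log_pos (by norm_num)
  have hterm : ∀ ω, p ω * Real.logb 2 (q (f ω) (g ω)) - p ω * Real.logb 2 (condProb p f g ω) ≤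
      (p ω * (q (f ω) (g ω) / condProb p f g ω) - p ω) / Real.log 2 := by
    intro ω
    have hc := condProb_pos hp f g ω
    rw [← mul_sub, ← Real.logb_div (hqpos ω).ne' hc.ne', Real.logb, ← mul_div_assoc]
    have hl := Real.log_le_sub_one_of_pos (div_pos (hqpos ω) hc)
    have := mul_le_mul_of_nonneg_left hl (hp ω).le
    gcongr
    linarith
  refine (Finset.sum_le_sum fun ω _ => hterm ω).trans ?_
  rw [← Finset.sum_div, Finset.sum_sub_distrib, hsum]
  refine div_nonpos_of_nonpos_of_nonneg (sub_nonpos.2 ?_) hlog2.le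
  calc ∑ ω, p ω * (q (f ω) (g ω) / condProb p f g ω)
      = ∑ ω, p ω * ((fun ab : A × B => q ab.1 ab.2 * prob p (fun ω' => g ω' = ab.2)) (f ω, g ω) /
          prob p (fun ω' => (f ω', g ω') = (f ω, g ω))) := by
        refine Finset.sum_congr rfl fun ω _ => ?_
        simp only [condProb, Prod.mk.injEq, div_div_eq_mul_div]
    _ = ∑ ab ∈ Finset.univ.image (fun ω => (f ω, g ω)),
          q ab.1 ab.2 * prob p (fun ω' => g ω' = ab.2) :=
        sum_mul_div_prob hp (fun ω => (f ω, g ω)) fun ab : A × B =>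
          q ab.1 ab.2 * prob p (fun ω' => g ω' = ab.2)
    _ ≤ ∑ ab ∈ Finset.univ.image f ×ˢ Finset.univ.image g,
          q ab.1 ab.2 * prob p (fun ω' => g ω' = ab.2) := by
        refine Finset.sum_le_sum_of_subset_of_nonneg ?_ fun ab _ _ =>
          mul_nonneg (hq _ _) (prob_nonneg hp _)
        intro ab hab
        obtain ⟨ω, -, rfl⟩ := Finset.mem_image.1 hab
        simp
    _ = ∑ b ∈ Finset.univ.image g,
          (∑ a ∈ Finset.univ.image f, q a b) * prob p (fun ω' => g ω' = b) := by
        rw [Finset.sum_product_right]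
        simp only [Finset.sum_mul]
    _ ≤ ∑ b ∈ Finset.univ.image g, 1 * prob p (fun ω' => g ω' = b) :=
        Finset.sum_le_sum fun b _ =>
          mul_le_mul_of_nonneg_right (hqsum b) (prob_nonneg hp _)
    _ = 1 := by simp only [one_mul, sum_prob_eq, hsum]

/-- Conditioning on more information does not increase entropy. -/
lemma condEnt_le_condEnt_comp {C : Type} {p : Ω → ℝ} (hp : ∀ ω, 0 < p ω)
    (hsum : ∑ ω, p ω = 1) (f : Ω → A) (h : Ω → C) (φ : C → B) :
    condEnt p f h ≤ condEnt p f (fun ω => φ (h ω)) := by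
  refine (condEnt_le_of_subprobability hp hsum f h
    (fun a c => prob p (fun ω => f ω = a ∧ φ (h ω) = φ c) / prob p (fun ω => φ (h ω) = φ c))
    (fun a c => div_nonneg (prob_nonneg hp _) (prob_nonneg hp _))
    (fun ω => condProb_pos hp f (fun ω => φ (h ω)) ω) (fun c => ?_)).trans
    (condEnt_eq_sum hp f (fun ω => φ (h ω))).ge
  rw [← Finset.sum_div, sum_prob_and_eq]
  exact div_self_le_one _

/-- The entropy of `f` is at most the logarithm of the size of its codomain. -/
lemma condEnt_le_logb_card [Fintype A] {p : Ω → ℝ} (hp : ∀ ω, 0 < p ω)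
    (hsum : ∑ ω, p ω = 1) (f : Ω → A) (g : Ω → B) :
    condEnt p f g ≤ Real.logb 2 (Fintype.card A) := by
  obtain ⟨ω₀⟩ : Nonempty Ω := by
    by_contra hne
    rw [not_nonempty_iff] at hne
    simp at hsum
  have hcard : (0 : ℝ) < Fintype.card A := by
    exact_mod_cast Fintype.card_pos_iff.2 ⟨f ω₀⟩
  refine (condEnt_le_of_subprobability hp hsum f g (fun _ _ => (Fintype.card A : ℝ)⁻¹)
    (fun _ _ => by positivity) (fun _ => by positivity) (fun _ => ?_)).trans_eq ?_
  · rw [Finset.sum_const, nsmul_eq_mul, ← div_eq_mul_inv, div_le_one hcard]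
    exact_mod_cast Finset.card_le_univ _
  · rw [← Finset.sum_mul, hsum, Real.logb_inv]
    ring

/-- Conditional entropy is invariant under a measure-preserving map `T` through which the
random variables factor up to injective relabelling. -/
lemma condEnt_eq_of_map {Ω' A' B' : Type} [Fintype Ω'] {p : Ω → ℝ} {p' : Ω' → ℝ}
    (hp : ∀ ω, 0 < p ω) (hp' : ∀ ω, 0 < p' ω) (T : Ω → Ω')
    (hT : ∀ F : Ω' → ℝ, ∑ ω, p ω * F (T ω) = ∑ ω, p' ω * F ω)
    (f : Ω → A) (g : Ω → B) (f' : Ω' → A') (g' : Ω' → B')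
    (hf : ∀ ω₁ ω₂, f ω₁ = f ω₂ ↔ f' (T ω₁) = f' (T ω₂))
    (hg : ∀ ω₁ ω₂, g ω₁ = g ω₂ ↔ g' (T ω₁) = g' (T ω₂)) :
    condEnt p f g = condEnt p' f' g' := by
  have hprob : ∀ E : Ω' → Prop, prob p (fun ω => E (T ω)) = prob p' E := by
    intro E
    rw [prob_eq_sum_ite, prob_eq_sum_ite]
    simpa using hT (fun ω => if E ω then 1 else 0)
  rw [condEnt_eq_sum hp, condEnt_eq_sum hp', ← hT]
  congr 1
  refine Finset.sum_congr rfl fun ω _ => ?_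
  congr 2
  unfold condProb
  simp only [hf, hg]
  rw [hprob (fun ω' => f' ω' = f' (T ω) ∧ g' ω' = g' (T ω)),
    hprob (fun ω' => g' ω' = g' (T ω))]

end Entropy

section Chain

variable {α β : ℝ}

lemma initD_pos (hα : 0 < α) (hβ : 0 < β) (b : Bool) : 0 < initD α β b := by
  cases b <;> simp [initD] <;> positivity

lemma transD_pos (hα : 0 < α ∧ α < 1) (hβ : 0 < β ∧ β < 1) (b b' : Bool) :
    0 < transD α β b b' := by
  cases b <;> cases b' <;> simp [transD, hα.1, hα.2, hβ.1, hβ.2]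

lemma pMarkov_pos (hα : 0 < α ∧ α < 1) (hβ : 0 < β ∧ β < 1) {m : ℕ} (d : Fin (m + 1) → Bool) :
    0 < pMarkov α β d :=
  mul_pos (initD_pos hα.1 hβ.1 _) (Finset.prod_pos fun _ _ => transD_pos hα hβ _ _)

lemma pJoint_pos (hα : 0 < α ∧ α < 1) (hβ : 0 < β ∧ β < 1) (n : ℕ)
    (ω : (Fin n → Bool) × (Fin (n + 2) → Bool)) : 0 < pJoint α β n ω :=
  mul_pos (by positivity) (pMarkov_pos hα hβ _)

lemma sum_initD (hα : 0 < α) (hβ : 0 < β) : ∑ b, initD α β b = 1 := by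
  have : α + β ≠ 0 := by positivity
  simp only [Fintype.sum_bool, initD, if_true, Bool.false_eq_true, if_false]
  field_simp
  ring

lemma sum_transD (b : Bool) : ∑ b', transD α β b b' = 1 := by
  cases b <;> simp [transD]

lemma sum_initD_mul_transD (hα : 0 < α) (hβ : 0 < β) (b' : Bool) :
    ∑ b, initD α β b * transD α β b b' = initD α β b' := by
  have : α + β ≠ 0 := by positivity
  cases b' <;> simp [transD, initD] <;> field_simp <;> ring

lemma pMarkov_snoc {m : ℕ} (d : Fin (m + 1) → Bool) (b : Bool) :
    pMarkov α β (m := m + 1) (Fin.snoc d b : Fin (m + 1 + 1) → Bool) =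
      pMarkov α β d * transD α β (d (Fin.last m)) b := by
  have h0 : (Fin.snoc d b : Fin (m + 1 + 1) → Bool) 0 = d 0 :=
    Fin.snoc_castSucc (α := fun _ => Bool) b d 0
  have h1 : ∀ i : Fin m, (Fin.snoc d b : Fin (m + 1 + 1) → Bool) i.castSucc.succ = d i.succ :=
    fun i => Fin.snoc_castSucc (α := fun _ => Bool) b d i.succ
  simp only [pMarkov, Fin.prod_univ_castSucc, h0, h1, Fin.snoc_castSucc, Fin.succ_last,
    Fin.snoc_last]
  ring

lemma sum_snoc {m : ℕ} (F : (Fin (m + 1) → Bool) → ℝ) :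
    ∑ d, F d = ∑ d : Fin m → Bool, ∑ b, F (Fin.snoc d b) := by
  rw [← (Fin.snocEquiv (fun _ : Fin (m + 1) => Bool)).sum_comp, Fintype.sum_prod_type,
    Finset.sum_comm]
  rfl

lemma sum_pMarkov_first (m : ℕ) (G : Bool → ℝ) :
    ∑ d : Fin (m + 1) → Bool, pMarkov α β d * G (d 0) = ∑ b, initD α β b * G b := by
  induction m with
  | zero =>
    rw [← (Equiv.funUnique (Fin 1) Bool).symm.sum_comp]
    simp [pMarkov]
  | succ m ih =>
    rw [sum_snoc, ← ih]
    refine Finset.sum_congr rfl fun d _ => ?_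
    have h0 : ∀ b, (Fin.snoc d b : Fin (m + 1 + 1) → Bool) 0 = d 0 :=
      fun b => Fin.snoc_castSucc (α := fun _ => Bool) b d 0
    simp only [pMarkov_snoc, h0]
    rw [← Finset.sum_mul, ← Finset.mul_sum, sum_transD, mul_one]

lemma sum_pMarkov_last (hα : 0 < α) (hβ : 0 < β) (m : ℕ) (G : Bool → ℝ) :
    ∑ d : Fin (m + 1) → Bool, pMarkov α β d * G (d (Fin.last m)) = ∑ b, initD α β b * G b := by
  induction m generalizing G with
  | zero => exact sum_pMarkov_first 0 G
  | succ m ih =>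
    rw [sum_snoc]
    simp only [pMarkov_snoc, Fin.snoc_last, mul_assoc]
    simp only [← Finset.mul_sum]
    rw [ih (fun c => ∑ b, transD α β c b * G b)]
    simp only [Finset.mul_sum]
    rw [Finset.sum_comm]
    simp only [← mul_assoc, ← Finset.sum_mul, sum_initD_mul_transD hα hβ]

lemma sum_pJoint_mul_pattern (n : ℕ) (G : (Fin (n + 2) → Bool) → ℝ) :
    ∑ ω, pJoint α β n ω * G ω.2 = ∑ d, pMarkov α β (m := n + 1) d * G d := by
  rw [Fintype.sum_prod_type]
  simp only [pJoint, mul_assoc]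
  simp [← Finset.mul_sum]

lemma sum_pJoint_first (n : ℕ) (G : Bool → ℝ) :
    ∑ ω, pJoint α β n ω * G (ω.2 0) = ∑ b, initD α β b * G b :=
  (sum_pJoint_mul_pattern n fun d => G (d 0)).trans (sum_pMarkov_first (n + 1) G)

lemma sum_pJoint_last (hα : 0 < α) (hβ : 0 < β) (n : ℕ) (G : Bool → ℝ) :
    ∑ ω, pJoint α β n ω * G (ω.2 (Fin.last (n + 1))) = ∑ b, initD α β b * G b :=
  (sum_pJoint_mul_pattern n fun d => G (d (Fin.last (n + 1)))).trans
    (sum_pMarkov_last hα hβ (n + 1) G)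

lemma sum_pJoint (hα : 0 < α) (hβ : 0 < β) (n : ℕ) : ∑ ω, pJoint α β n ω = 1 := by
  simpa only [mul_one, sum_initD hα hβ] using sum_pJoint_first (α := α) (β := β) n fun _ => 1

end Chain

section Splitting

variable {α β : ℝ} {n m : ℕ}

/-- The first `n` source bits together with the pattern bits `D_0, …, D_{n+1}`. -/
def leftPart (ω : (Fin (n + 1 + m) → Bool) × (Fin (n + 1 + m + 2) → Bool)) :
    (Fin n → Bool) × (Fin (n + 2) → Bool) :=
  (fun i => ω.1 ⟨i, by omega⟩, fun i => ω.2 ⟨i, by omega⟩)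

/-- The last `m` source bits together with the pattern bits `D_{n+1}, …, D_{n+m+2}`. -/
def rightPart (ω : (Fin (n + 1 + m) → Bool) × (Fin (n + 1 + m + 2) → Bool)) :
    (Fin m → Bool) × (Fin (m + 2) → Bool) :=
  (fun i => ω.1 ⟨n + 1 + i, by omega⟩, fun i => ω.2 ⟨n + 1 + i, by omega⟩)

/-- The source bit `X_{n+1}` separating the two parts. -/
def midBit (ω : (Fin (n + 1 + m) → Bool) × (Fin (n + 1 + m + 2) → Bool)) : Bool :=
  ω.1 ⟨n, by omega⟩

/-- Reassemble an outcome from its two parts and the separating bit. -/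
def glue (ω₁ : (Fin n → Bool) × (Fin (n + 2) → Bool)) (ω₂ : (Fin m → Bool) × (Fin (m + 2) → Bool))
    (b : Bool) : (Fin (n + 1 + m) → Bool) × (Fin (n + 1 + m + 2) → Bool) :=
  (fun i => if h : i.val < n then ω₁.1 ⟨i, h⟩ else
      if h' : i.val = n then b else ω₂.1 ⟨i - (n + 1), by omega⟩,
    fun i => if h : i.val < n + 2 then ω₁.2 ⟨i, h⟩ else ω₂.2 ⟨i - (n + 1), by omega⟩)

lemma leftPart_last (ω : (Fin (n + 1 + m) → Bool) × (Fin (n + 1 + m + 2) → Bool)) :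
    (leftPart ω).2 (Fin.last (n + 1)) = (rightPart ω).2 0 := rfl

lemma source_eq_iff (ω ω' : (Fin (n + 1 + m) → Bool) × (Fin (n + 1 + m + 2) → Bool)) :
    ω.1 = ω'.1 ↔ (leftPart ω).1 = (leftPart ω').1 ∧ (rightPart ω).1 = (rightPart ω').1 ∧
      midBit ω = midBit ω' := by
  constructor
  · intro h
    simp [leftPart, rightPart, midBit, h]
  · rintro ⟨h₁, h₂, h₃⟩
    funext i
    rcases lt_trichotomy i.val n with h | h | h
    · exact congrFun h₁ ⟨i, h⟩
    · have hi : i = ⟨n, by omega⟩ := Fin.ext h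
      rw [hi]
      exact h₃
    · obtain ⟨j, hj⟩ := Nat.exists_eq_add_of_lt h
      have hi : i = ⟨n + 1 + j, by omega⟩ := Fin.ext (by simp; omega)
      rw [hi]
      exact congrFun h₂ ⟨j, by omega⟩

lemma glue_parts (ω : (Fin (n + 1 + m) → Bool) × (Fin (n + 1 + m + 2) → Bool)) :
    glue (leftPart ω) (rightPart ω) (midBit ω) = ω := by
  refine Prod.ext (funext fun i => ?_) (funext fun i => ?_)
  · simp only [glue, leftPart, rightPart, midBit]
    split_ifs with h h'
    · rfl
    · exact congrArg ω.1 (Fin.ext h'.symm)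
    · exact congrArg ω.1 (Fin.ext (by simp; omega))
  · simp only [glue, leftPart, rightPart]
    split_ifs with h
    · rfl
    · exact congrArg ω.2 (Fin.ext (by simp; omega))

lemma leftPart_glue (ω₁ : (Fin n → Bool) × (Fin (n + 2) → Bool))
    (ω₂ : (Fin m → Bool) × (Fin (m + 2) → Bool)) (b : Bool) :
    leftPart (glue ω₁ ω₂ b) = ω₁ := by
  refine Prod.ext (funext fun i => ?_) (funext fun i => ?_) <;> simp [glue, leftPart]

lemma rightPart_glue (ω₁ : (Fin n → Bool) × (Fin (n + 2) → Bool))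
    (ω₂ : (Fin m → Bool) × (Fin (m + 2) → Bool)) (b : Bool)
    (h : ω₁.2 (Fin.last (n + 1)) = ω₂.2 0) :
    rightPart (glue ω₁ ω₂ b) = ω₂ := by
  refine Prod.ext (funext fun i => ?_) (funext fun i => ?_)
  · simp only [glue, rightPart]
    rw [dif_neg (by omega), dif_neg (by omega)]
    exact congrArg ω₂.1 (Fin.ext (by simp))
  · simp only [glue, rightPart]
    split_ifs with hi
    · obtain rfl : i = 0 := Fin.ext (by rw [Fin.val_zero]; omega)
      exact h
    · exact congrArg ω₂.2 (Fin.ext (by simp))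

lemma midBit_glue (ω₁ : (Fin n → Bool) × (Fin (n + 2) → Bool))
    (ω₂ : (Fin m → Bool) × (Fin (m + 2) → Bool)) (b : Bool) :
    midBit (glue ω₁ ω₂ b) = b := by
  simp [glue, midBit]

lemma pJoint_eq_mul_div (hα : 0 < α) (hβ : 0 < β)
    (ω : (Fin (n + 1 + m) → Bool) × (Fin (n + 1 + m + 2) → Bool)) :
    pJoint α β (n + 1 + m) ω = pJoint α β n (leftPart ω) * pJoint α β m (rightPart ω) /
      (2 * initD α β ((rightPart ω).2 0)) := by
  have hc := (initD_pos hα hβ ((rightPart ω).2 0)).ne'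
  have hprod : ∏ i : Fin (n + 1 + m + 1), transD α β (ω.2 i.castSucc) (ω.2 i.succ) =
      (∏ i : Fin (n + 1), transD α β ((leftPart ω).2 i.castSucc) ((leftPart ω).2 i.succ)) *
      ∏ i : Fin (m + 1), transD α β ((rightPart ω).2 i.castSucc) ((rightPart ω).2 i.succ) :=
    Fin.prod_univ_add (a := n + 1) (b := m + 1)
      fun i => transD α β (ω.2 i.castSucc) (ω.2 i.succ)
  have h0 : (leftPart ω).2 0 = ω.2 0 := rfl
  simp only [pJoint, pMarkov, hprod, h0]
  field_simp
  ring

/-- Expectations over the joined outcome as sums over compatible pairs of parts. -/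
lemma sum_pJoint_split (hα : 0 < α) (hβ : 0 < β)
    (F : (Fin n → Bool) × (Fin (n + 2) → Bool) → (Fin m → Bool) × (Fin (m + 2) → Bool) →
      Bool → ℝ) :
    ∑ ω, pJoint α β (n + 1 + m) ω * F (leftPart ω) (rightPart ω) (midBit ω) =
      ∑ ω₁, ∑ ω₂, ∑ b, if ω₁.2 (Fin.last (n + 1)) = ω₂.2 0 then
        pJoint α β n ω₁ * pJoint α β m ω₂ / (2 * initD α β (ω₂.2 0)) * F ω₁ ω₂ b else 0 := by
  simp only [← Fintype.sum_prod_type']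
  rw [← Finset.sum_filter]
  refine Finset.sum_nbij' (fun ω => (leftPart ω, rightPart ω, midBit ω))
    (fun t => glue t.1 t.2.1 t.2.2) ?_ ?_ ?_ ?_ ?_
  · intro ω _
    simp [leftPart_last]
  · simp
  · intro ω _
    exact glue_parts ω
  · intro t ht
    simp only [Finset.mem_filter, Finset.mem_univ, true_and] at ht
    simp only [leftPart_glue, rightPart_glue _ _ _ ht, midBit_glue]
  · intro ω _
    rw [pJoint_eq_mul_div hα hβ]

lemma sum_pJoint_leftPart (hα : 0 < α) (hβ : 0 < β)
    (F : (Fin n → Bool) × (Fin (n + 2) → Bool) → ℝ) :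
    ∑ ω : (Fin (n + 1 + m) → Bool) × (Fin (n + 1 + m + 2) → Bool),
      pJoint α β (n + 1 + m) ω * F (leftPart ω) = ∑ ω, pJoint α β n ω * F ω := by
  rw [sum_pJoint_split hα hβ fun ω₁ _ _ => F ω₁]
  refine Finset.sum_congr rfl fun ω₁ _ => ?_
  have hc := (initD_pos hα hβ (ω₁.2 (Fin.last (n + 1)))).ne'
  have h := sum_pJoint_first (α := α) (β := β) m fun c =>
    if ω₁.2 (Fin.last (n + 1)) = c then pJoint α β n ω₁ * F ω₁ / initD α β c else 0
  rw [Finset.sum_eq_single (ω₁.2 (Fin.last (n + 1))) (by grind) (by simp), if_pos rfl,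
    mul_div_cancel₀ _ hc] at h
  rw [← h]
  refine Finset.sum_congr rfl fun ω₂ _ => ?_
  simp only [Finset.sum_const, Finset.card_univ, Fintype.card_bool, nsmul_eq_mul]
  split_ifs
  · push_cast
    field_simp
  · simp

lemma sum_pJoint_rightPart (hα : 0 < α) (hβ : 0 < β)
    (F : (Fin m → Bool) × (Fin (m + 2) → Bool) → ℝ) :
    ∑ ω : (Fin (n + 1 + m) → Bool) × (Fin (n + 1 + m + 2) → Bool),
      pJoint α β (n + 1 + m) ω * F (rightPart ω) = ∑ ω, pJoint α β m ω * F ω := by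
  rw [sum_pJoint_split hα hβ fun _ ω₂ _ => F ω₂, Finset.sum_comm]
  refine Finset.sum_congr rfl fun ω₂ _ => ?_
  have hc := (initD_pos hα hβ (ω₂.2 0)).ne'
  have h := sum_pJoint_last (α := α) (β := β) hα hβ n fun c =>
    if c = ω₂.2 0 then pJoint α β m ω₂ * F ω₂ / initD α β c else 0
  rw [Finset.sum_eq_single (ω₂.2 0) (by grind) (by simp), if_pos rfl,
    mul_div_cancel₀ _ hc] at h
  rw [← h]
  refine Finset.sum_congr rfl fun ω₁ _ => ?_
  simp only [Finset.sum_const, Finset.card_univ, Fintype.card_bool, nsmul_eq_mul]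
  split_ifs with hEq
  · rw [hEq]
    push_cast
    field_simp
  · simp

/-- Given the shared pattern bit, events on the two parts and the separating bit are
independent. -/
lemma prob_split (hα : 0 < α) (hβ : 0 < β) (c b : Bool)
    {E₁ : (Fin n → Bool) × (Fin (n + 2) → Bool) → Prop}
    {E₂ : (Fin m → Bool) × (Fin (m + 2) → Bool) → Prop}
    (h₁ : ∀ ω, E₁ ω → ω.2 (Fin.last (n + 1)) = c) (h₂ : ∀ ω, E₂ ω → ω.2 0 = c) :
    prob (pJoint α β (n + 1 + m))
        (fun ω => E₁ (leftPart ω) ∧ E₂ (rightPart ω) ∧ midBit ω = b) =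
      prob (pJoint α β n) E₁ * prob (pJoint α β m) E₂ / (2 * initD α β c) := by
  have h := sum_pJoint_split (n := n) (m := m) hα hβ fun ω₁ ω₂ b' =>
    if E₁ ω₁ ∧ E₂ ω₂ ∧ b' = b then 1 else 0
  simp only [mul_ite, mul_one, mul_zero] at h
  rw [prob_eq_sum_ite]
  refine Eq.trans (by congr!) (h.trans ?_)
  rw [prob_eq_sum_ite, prob_eq_sum_ite, Finset.sum_mul_sum, Finset.sum_div]
  refine Finset.sum_congr rfl fun ω₁ _ => ?_
  rw [Finset.sum_div]
  refine Finset.sum_congr rfl fun ω₂ _ => ?_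
  by_cases hE₁ : E₁ ω₁
  · by_cases hE₂ : E₂ ω₂
    · simp [hE₁, hE₂, h₁ _ hE₁, h₂ _ hE₂]
    · simp [hE₂]
  · simp [hE₁]

lemma yList_append {x₁ d₁ : List Bool} (x₂ d₂ : List Bool) (h : x₁.length = d₁.length) :
    yList (x₁ ++ x₂) (d₁ ++ d₂) = yList x₁ d₁ ++ yList x₂ d₂ := by
  simp [yList, List.zip_append h]

lemma ofFn_split {γ : Type} (f : Fin (n + 1 + m) → γ) :
    List.ofFn f = List.ofFn (fun i : Fin n => f ⟨i, by omega⟩) ++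
      ([f ⟨n, by omega⟩] ++ List.ofFn (fun i : Fin m => f ⟨n + 1 + i, by omega⟩)) := by
  rw [List.ofFn_add, List.ofFn_succ', List.concat_eq_append, List.append_assoc]
  rfl

lemma yOut_split (ω : (Fin (n + 1 + m) → Bool) × (Fin (n + 1 + m + 2) → Bool)) :
    yOut ω = yOut (leftPart ω) ++
      (yList [midBit ω] [(rightPart ω).2 0] ++ yOut (rightPart ω)) := by
  unfold yOut
  rw [ofFn_split ω.1, ofFn_split (fun i : Fin (n + 1 + m) => ω.2 ⟨i.val + 1, _⟩),
    yList_append _ _ (by simp), yList_append _ _ (by simp)]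
  rfl

end Splitting

section Limit

variable {α β : ℝ}

/-- The output together with the two boundary pattern bits, as conditioned on in `aSeq`. -/
def observed {n : ℕ} (ω : (Fin n → Bool) × (Fin (n + 2) → Bool)) : List Bool × Bool × Bool :=
  (yOut ω, ω.2 0, ω.2 (Fin.last (n + 1)))

lemma condProb_split (hα : 0 < α ∧ α < 1) (hβ : 0 < β ∧ β < 1) {n m : ℕ}
    (ω : (Fin (n + 1 + m) → Bool) × (Fin (n + 1 + m + 2) → Bool)) :
    condProb (pJoint α β (n + 1 + m)) Prod.fst
        (fun ω => (observed (leftPart ω), observed (rightPart ω), midBit ω)) ω =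
      condProb (pJoint α β n) Prod.fst observed (leftPart ω) *
        condProb (pJoint α β m) Prod.fst observed (rightPart ω) := by
  have hlast : ∀ ω₁ : (Fin n → Bool) × (Fin (n + 2) → Bool),
      observed ω₁ = observed (leftPart ω) → ω₁.2 (Fin.last (n + 1)) = (rightPart ω).2 0 :=
    fun ω₁ h => congrArg (fun t => t.2.2) h
  have hfirst : ∀ ω₂ : (Fin m → Bool) × (Fin (m + 2) → Bool),
      observed ω₂ = observed (rightPart ω) → ω₂.2 0 = (rightPart ω).2 0 :=
    fun ω₂ h => congrArg (fun t => t.2.1) h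
  have hnum := prob_split hα.1 hβ.1 ((rightPart ω).2 0) (midBit ω)
    (E₁ := fun ω' => ω'.1 = (leftPart ω).1 ∧ observed ω' = observed (leftPart ω))
    (E₂ := fun ω' => ω'.1 = (rightPart ω).1 ∧ observed ω' = observed (rightPart ω))
    (fun ω₁ h => hlast ω₁ h.2) (fun ω₂ h => hfirst ω₂ h.2)
  have hden := prob_split hα.1 hβ.1 ((rightPart ω).2 0) (midBit ω) hlast hfirst
  have hnum' : (fun ω' : (Fin (n + 1 + m) → Bool) × (Fin (n + 1 + m + 2) → Bool) =>
      ω'.1 = ω.1 ∧ (observed (leftPart ω'), observed (rightPart ω'), midBit ω') =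
        (observed (leftPart ω), observed (rightPart ω), midBit ω)) = fun ω' =>
      ((leftPart ω').1 = (leftPart ω).1 ∧ observed (leftPart ω') = observed (leftPart ω)) ∧
      ((rightPart ω').1 = (rightPart ω).1 ∧ observed (rightPart ω') = observed (rightPart ω)) ∧
      midBit ω' = midBit ω := by
    funext ω'
    simp only [source_eq_iff, Prod.mk.injEq, eq_iff_iff]
    tauto
  have h₁ : 0 < prob (pJoint α β n) (fun ω' => observed ω' = observed (leftPart ω)) :=
    prob_pos (pJoint_pos hα hβ n) rfl
  have h₂ : 0 < prob (pJoint α β m) (fun ω' => observed ω' = observed (rightPart ω)) :=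
    prob_pos (pJoint_pos hα hβ m) rfl
  have hc := initD_pos hα.1 hβ.1 ((rightPart ω).2 0)
  unfold condProb
  rw [hnum', hnum]
  simp only [Prod.mk.injEq]
  rw [hden]
  field_simp

/-- Superadditivity: revealing the bit `X_{n+1}`, its pattern bit and where the output splits
decouples the two parts. -/
lemma aSeq_add_le (hα : 0 < α ∧ α < 1) (hβ : 0 < β ∧ β < 1) (n m : ℕ) :
    aSeq α β n + aSeq α β m ≤ aSeq α β (n + 1 + m) := by
  have hle := condEnt_le_condEnt_comp (pJoint_pos hα hβ (n + 1 + m))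
    (sum_pJoint hα.1 hβ.1 (n + 1 + m)) Prod.fst
    (fun ω => (observed (leftPart ω), observed (rightPart ω), midBit ω))
    (fun t => (t.1.1 ++ (yList [t.2.2] [t.2.1.2.1] ++ t.2.1.1), t.1.2.1, t.2.1.2.2))
  have hobs : (fun ω : (Fin (n + 1 + m) → Bool) × (Fin (n + 1 + m + 2) → Bool) =>
      ((observed (leftPart ω)).1 ++ (yList [midBit ω] [(observed (rightPart ω)).2.1] ++
        (observed (rightPart ω)).1), (observed (leftPart ω)).2.1,
        (observed (rightPart ω)).2.2)) =
      fun ω => (yOut ω, ω.2 0, ω.2 (Fin.last (n + 1 + m + 1))) := by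
    funext ω
    rw [yOut_split]
    rfl
  refine le_trans (le_of_eq ?_) (hle.trans_eq (congrArg _ hobs))
  have hsplit : condEnt (pJoint α β (n + 1 + m)) Prod.fst
      (fun ω => (observed (leftPart ω), observed (rightPart ω), midBit ω)) =
      condEnt (pJoint α β n) Prod.fst observed + condEnt (pJoint α β m) Prod.fst observed := by
    rw [condEnt_eq_sum (pJoint_pos hα hβ _), condEnt_eq_sum (pJoint_pos hα hβ _),
      condEnt_eq_sum (pJoint_pos hα hβ _),
      ← sum_pJoint_leftPart (m := m) hα.1 hβ.1 fun ω =>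
        Real.logb 2 (condProb (pJoint α β n) Prod.fst observed ω),
      ← sum_pJoint_rightPart (n := n) hα.1 hβ.1 fun ω =>
        Real.logb 2 (condProb (pJoint α β m) Prod.fst observed ω),
      ← neg_add, ← Finset.sum_add_distrib]
    congr 1
    refine Finset.sum_congr rfl fun ω _ => ?_
    rw [condProb_split hα hβ, Real.logb_mul (condProb_pos (pJoint_pos hα hβ _) _ _ _).ne'
      (condProb_pos (pJoint_pos hα hβ _) _ _ _).ne', mul_add]
  exact hsplit.symm

lemma aSeq_le (hα : 0 < α ∧ α < 1) (hβ : 0 < β ∧ β < 1) (n : ℕ) : aSeq α β n ≤ n := by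
  refine (condEnt_le_logb_card (pJoint_pos hα hβ n) (sum_pJoint hα.1 hβ.1 n) _ _).trans_eq ?_
  simp [Real.logb_pow]

/-- Stationarity: the inner entropy is the full entropy of a block shorter by two. -/
lemma innerEnt_add_two (hα : 0 < α ∧ α < 1) (hβ : 0 < β ∧ β < 1) (n : ℕ) :
    innerEnt α β (n + 2) = aSeq α β n := by
  obtain ⟨k, hk⟩ : ∃ k, k = 0 + 1 + (n + 1 + 0) := ⟨_, rfl⟩
  have hkn : n + 2 = k := by omega
  rw [hkn]
  subst hk
  have hlen : 0 + 1 + (n + 1 + 0) - 2 = n := by omega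
  refine condEnt_eq_of_map (pJoint_pos hα hβ _) (pJoint_pos hα hβ _)
    (fun ω => leftPart (n := n) (m := 0) (rightPart (n := 0) (m := n + 1 + 0) ω))
    (fun F => ?_) _ _ _ _ (fun ω₁ ω₂ => ?_) (fun ω₁ ω₂ => ?_)
  · rw [sum_pJoint_rightPart (n := 0) hα.1 hβ.1 fun ω => F (leftPart ω),
      sum_pJoint_leftPart hα.1 hβ.1]
  · constructor
    · intro h
      funext i
      have := congrFun h ⟨i, by omega⟩
      simpa [leftPart, rightPart, add_comm] using this
    · intro h
      funext i
      have := congrFun h ⟨i, by omega⟩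
      simpa [leftPart, rightPart, add_comm] using this
  · have hy : ∀ ω : (Fin (0 + 1 + (n + 1 + 0)) → Bool) × (Fin (0 + 1 + (n + 1 + 0) + 2) → Bool),
        yList (List.ofFn fun i : Fin (0 + 1 + (n + 1 + 0) - 2) => ω.1 ⟨i.val + 1, by omega⟩)
          (List.ofFn fun i : Fin (0 + 1 + (n + 1 + 0) - 2) => ω.2 ⟨i.val + 2, by omega⟩) =
        yOut (leftPart (n := n) (m := 0) (rightPart (n := 0) (m := n + 1 + 0) ω)) := by
      intro ω
      rw [List.ofFn_congr hlen, List.ofFn_congr hlen]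
      unfold yOut
      congr 2
      · funext i
        exact congrArg ω.1 (Fin.ext (by simp; omega))
      · funext i
        exact congrArg ω.2 (Fin.ext (by simp; omega))
    have h0 : ∀ ω : (Fin (0 + 1 + (n + 1 + 0)) → Bool) × (Fin (0 + 1 + (n + 1 + 0) + 2) → Bool),
        ω.2 1 = (leftPart (n := n) (m := 0) (rightPart (n := 0) (m := n + 1 + 0) ω)).2 0 :=
      fun ω => congrArg ω.2 (Fin.ext (by simp))
    have h1 : ∀ ω : (Fin (0 + 1 + (n + 1 + 0)) → Bool) × (Fin (0 + 1 + (n + 1 + 0) + 2) → Bool),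
        ω.2 ⟨0 + 1 + (n + 1 + 0), by omega⟩ =
          (leftPart (n := n) (m := 0) (rightPart (n := 0) (m := n + 1 + 0) ω)).2
            (Fin.last (n + 1)) :=
      fun ω => rfl
    simp only [hy, h0, h1]

/-- A superadditive-with-gap sequence of at most linear growth has a limiting slope. -/
lemma exists_tendsto_div_of_add_le {a : ℕ → ℝ} (hadd : ∀ n m, a n + a m ≤ a (n + 1 + m))
    (hle : ∀ n, a n ≤ n) :
    ∃ L, Tendsto (fun n : ℕ => a n / (n + 1 : ℕ)) atTop (nhds L) := by
  let u : ℕ → ℝ := fun n => n.casesOn 0 fun k => -a k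
  have hsub : Subadditive u := by
    rintro (_ | n) (_ | m)
    · simp [u]
    · simp [u]
    · simp [u]
    · have h : n + 1 + (m + 1) = (n + 1 + m) + 1 := rfl
      rw [h]
      change -a (n + 1 + m) ≤ -a n + -a m
      linarith [hadd n m]
  have hbdd : BddBelow (Set.range fun n => u n / n) := by
    refine ⟨-1, ?_⟩
    rintro _ ⟨_ | n, rfl⟩
    · simp
    · change -1 ≤ -a n / ((n + 1 : ℕ) : ℝ)
      have hn : (0 : ℝ) < (n + 1 : ℕ) := by positivity
      rw [le_div_iff₀ hn]
      push_cast
      linarith [hle n]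
  refine ⟨-hsub.lim, ?_⟩
  have h := ((tendsto_add_atTop_iff_nat 1).2 (hsub.tendsto_lim hbdd)).neg
  refine h.congr fun n => ?_
  change -(-a n / ((n + 1 : ℕ) : ℝ)) = _
  ring

end Limit

/-- For every `α, β ∈ (0,1)`, the limits
`lim_k (1/k) H(X_2^{k−1} | y(X_2^{k−1},D_2^{k−1}), D_1, D_k)` and
`lim_k (1/k) H(X^k | y(X^k,D^k), D_0, D_{k+1})` both exist and are equal. -/
theorem inner_and_full_entropy_limits_equal (α β : ℝ) (hα : 0 < α ∧ α < 1)
    (hβ : 0 < β ∧ β < 1) :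
    ∃ L : ℝ,
      Tendsto (fun k : ℕ => innerEnt α β k / k) atTop (nhds L) ∧
      Tendsto (fun k : ℕ => aSeq α β k / k) atTop (nhds L) := by
  obtain ⟨L, hL⟩ := exists_tendsto_div_of_add_le (aSeq_add_le hα hβ) (aSeq_le hα hβ)
  have hratio : Tendsto (fun n : ℕ => ((n + 1 : ℕ) : ℝ) / n) atTop (nhds 1) := by
    have h := tendsto_one_div_atTop_nhds_zero_nat (𝕜 := ℝ)
    have h2 := h.const_add 1
    rw [add_zero] at h2
    refine h2.congr' ?_
    filter_upwards [eventually_gt_atTop 0] with n hn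
    have : (n : ℝ) ≠ 0 := by positivity
    push_cast
    field_simp
  refine ⟨L, ?_, ?_⟩
  · rw [← tendsto_add_atTop_iff_nat 2]
    have h := hL.div ((tendsto_add_atTop_iff_nat 1).2 hratio) one_ne_zero
    rw [div_one] at h
    refine h.congr fun n => ?_
    rw [innerEnt_add_two hα hβ, Pi.div_apply]
    push_cast
    field_simp
    ring
  · have h := hL.mul hratio
    rw [mul_one] at h
    refine h.congr' ?_
    filter_upwards [eventually_gt_atTop 0] with n hn
    have : (n : ℝ) ≠ 0 := by positivity
    push_cast
    field_simp
end SyncDeletion
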